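/- Given a conformal structure on U ⊆ ℝ^V for a triangle collection 𝒯, let f : (−ε, ε) → U be a smooth curve. Then for every vertex i, at t = 0, (d/dt) K_i(f(t)) = −Σ_{{i,j,k} ∈ 𝒯} [ (h_{ij,k}/ℓ_ij)(f_j′ − f_i′) + (h_{ik,j}/ℓ_ik)(f_k′ − f_i′) ] = −Σ_{j : {i,j} an edge} (ℓ*_ij/ℓ_ij)(f_j′ − f_i′). -/

import Mathlib

open Finset

/-- The angle at the vertex of a Euclidean triangle whose two adjacent sides have
lengths `a`, `b` and whose opposite side has length `c` (law of cosines). -/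
noncomputable def triAngle (a b c : ℝ) : ℝ :=
  Real.arccos ((a ^ 2 + b ^ 2 - c ^ 2) / (2 * a * b))

/-- `{i, j}` is an edge of the triangle collection `𝒯`. -/
def IsEdge {V : Type*} [DecidableEq V] (𝒯 : Finset (Finset V)) (i j : V) : Prop :=
  i ≠ j ∧ ∃ T ∈ 𝒯, i ∈ T ∧ j ∈ T

instance {V : Type*} [DecidableEq V] (𝒯 : Finset (Finset V)) (i j : V) :
    Decidable (IsEdge 𝒯 i j) := by
  unfold IsEdge; infer_instance

/-- A (two-dimensional) conformal structure on an open set `U ⊆ ℝ^V` for a collection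
`𝒯` of triangles: a smooth assignment `f ↦ d f i j` of reals to ordered edges, where
`d f i j` depends only on the coordinates `f i` and `f j`, the induced lengths
`ℓ i j = d i j + d j i` are positive and satisfy the strict triangle inequality on each
triangle, the metric condition holds on each triangle, and `∂ℓ_ij/∂f_i = d_ij`. -/
structure Conformal2D (V : Type*) [Fintype V] [DecidableEq V]
    (𝒯 : Finset (Finset V)) (U : Set (V → ℝ)) where
  d : (V → ℝ) → V → V → ℝ
  openU : IsOpen U
  card3 : ∀ T ∈ 𝒯, T.card = 3
  smooth : ∀ i j, IsEdge 𝒯 i j → ContDiffOn ℝ (⊤ : ℕ∞) (fun f => d f i j) U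
  localDep : ∀ i j, IsEdge 𝒯 i j → ∀ f g : V → ℝ, f i = g i → f j = g j →
    d f i j = d g i j
  lenPos : ∀ f ∈ U, ∀ i j, IsEdge 𝒯 i j → 0 < d f i j + d f j i
  triIneq : ∀ f ∈ U, ∀ T ∈ 𝒯, ∀ i ∈ T, ∀ j ∈ T, ∀ k ∈ T, i ≠ j → i ≠ k → j ≠ k →
    d f i j + d f j i < (d f i k + d f k i) + (d f j k + d f k j)
  metricCond : ∀ f ∈ U, ∀ T ∈ 𝒯, ∀ i ∈ T, ∀ j ∈ T, ∀ k ∈ T, i ≠ j → i ≠ k → j ≠ k →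
    d f i j ^ 2 + d f j k ^ 2 + d f k i ^ 2 = d f j i ^ 2 + d f k j ^ 2 + d f i k ^ 2
  derivLen : ∀ i j, IsEdge 𝒯 i j → ∀ f ∈ U,
    HasDerivAt (fun s : ℝ =>
        d (Function.update f i s) i j + d (Function.update f i s) j i)
      (d f i j) (f i)

namespace Conformal2D

variable {V : Type*} [Fintype V] [DecidableEq V] {𝒯 : Finset (Finset V)}
  {U : Set (V → ℝ)}

/-- The length `ℓ_ij = d_ij + d_ji`. -/
noncomputable def len (C : Conformal2D V 𝒯 U) (f : V → ℝ) (i j : V) : ℝ :=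
  C.d f i j + C.d f j i

/-- The angle `γ_{i,jk}` at vertex `i` in the triangle `{i, j, k}`. -/
noncomputable def ang (C : Conformal2D V 𝒯 U) (f : V → ℝ) (i j k : V) : ℝ :=
  triAngle (C.len f i j) (C.len f i k) (C.len f j k)

/-- `h_{ij,k} = (d_ik − d_ij cos γ_{i,jk}) / sin γ_{i,jk}`. -/
noncomputable def hh (C : Conformal2D V 𝒯 U) (f : V → ℝ) (i j k : V) : ℝ :=
  (C.d f i k - C.d f i j * Real.cos (C.ang f i j k)) / Real.sin (C.ang f i j k)

/-- The curvature `K_i = 2π − Σ_{{i,j,k} ∈ 𝒯} γ_{i,jk}` (each unordered triangle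
containing `i` counted once; the ordered double sum counts it twice, whence `1/2`). -/
noncomputable def K (C : Conformal2D V 𝒯 U) (f : V → ℝ) (i : V) : ℝ :=
  2 * Real.pi - (1 / 2) * ∑ j : V, ∑ k : V,
    if ({i, j, k} : Finset V) ∈ 𝒯 ∧ i ≠ j ∧ i ≠ k ∧ j ≠ k then C.ang f i j k else 0

/-- The dual length `ℓ*_ij = Σ_{{i,j,k} ∈ 𝒯} h_{ij,k}`. -/
noncomputable def dualLen (C : Conformal2D V 𝒯 U) (f : V → ℝ) (i j : V) : ℝ :=
  ∑ k : V,
    if ({i, j, k} : Finset V) ∈ 𝒯 ∧ i ≠ j ∧ i ≠ k ∧ j ≠ k then C.hh f i j k else 0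

end Conformal2D

/-- Strict triangle inequalities keep the cosine from the law of cosines strictly between
`-1` and `1`. -/
lemma abs_lt_one_cosine_law {a b c : ℝ} (ha : 0 < a) (hb : 0 < b) (h₁ : a < b + c)
    (h₂ : b < a + c) (h₃ : c < a + b) : |(a ^ 2 + b ^ 2 - c ^ 2) / (2 * a * b)| < 1 := by
  have hab : 0 < 2 * a * b := by positivity
  rw [abs_lt, lt_div_iff₀ hab, div_lt_one hab]
  constructor <;> nlinarith

/-- The cosine of `triAngle` is given by the law of cosines. -/
lemma cos_triAngle {a b c : ℝ} (h : |(a ^ 2 + b ^ 2 - c ^ 2) / (2 * a * b)| ≤ 1) :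
    Real.cos (triAngle a b c) = (a ^ 2 + b ^ 2 - c ^ 2) / (2 * a * b) :=
  Real.cos_arccos (abs_le.mp h).1 (abs_le.mp h).2

lemma triAngle_comm (a b c : ℝ) : triAngle a b c = triAngle b a c := by
  unfold triAngle
  congr 1
  ring

/-- Derivative of the angle of a triangle with varying side lengths. -/
lemma HasDerivAt.triAngle {a b c : ℝ → ℝ} {a' b' c' t : ℝ} (ha : HasDerivAt a a' t)
    (hb : HasDerivAt b b' t) (hc : HasDerivAt c c' t) (ha0 : 0 < a t) (hb0 : 0 < b t)
    (h₁ : a t < b t + c t) (h₂ : b t < a t + c t) (h₃ : c t < a t + b t) :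
    HasDerivAt (fun s => triAngle (a s) (b s) (c s))
      ((Real.cos (triAngle (a t) (b t) (c t)) * (a' / a t + b' / b t)
          - (a t * a' + b t * b' - c t * c') / (a t * b t))
        / Real.sin (triAngle (a t) (b t) (c t))) t := by
  have hq := abs_lt_one_cosine_law ha0 hb0 h₁ h₂ h₃
  have hlt := abs_lt.mp hq
  have hquot := (((ha.pow 2).add (hb.pow 2)).sub (hc.pow 2)).div
    ((ha.const_mul 2).mul hb) (mul_pos (mul_pos two_pos ha0) hb0).ne'
  have key := (Real.hasDerivAt_arccos hlt.1.ne' hlt.2.ne).comp t hquot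
  refine key.congr_deriv ?_
  have hsin : 0 < √(1 - ((a t ^ 2 + b t ^ 2 - c t ^ 2) / (2 * a t * b t)) ^ 2) :=
    Real.sqrt_pos.mpr (by nlinarith [hlt.1, hlt.2])
  rw [cos_triAngle hq.le]
  simp only [_root_.triAngle, Real.sin_arccos]
  generalize √(1 - ((a t ^ 2 + b t ^ 2 - c t ^ 2) / (2 * a t * b t)) ^ 2) = r at hsin ⊢
  simp
  field_simp
  ring

/-- A continuous linear form on `ℝ^V` that vanishes on the coordinate vectors other than the
`i`-th and `j`-th ones is determined by its values on those two. -/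
lemma ContinuousLinearMap.apply_eq_of_vanish_off_pair {V : Type*} [Fintype V] [DecidableEq V]
    (L : (V → ℝ) →L[ℝ] ℝ) {i j : V} (hij : i ≠ j)
    (h : ∀ k, k ≠ i → k ≠ j → L (Pi.single k 1) = 0) (v : V → ℝ) :
    L v = L (Pi.single i 1) * v i + L (Pi.single j 1) * v j := by
  have hv : L v = ∑ k, L (Pi.single k 1) * v k := by
    conv_lhs => rw [pi_eq_sum_univ' v, map_sum]
    refine Finset.sum_congr rfl fun k _ => ?_
    rw [map_smul, smul_eq_mul, mul_comm]
  rw [hv, ← Finset.sum_subset (Finset.subset_univ {i, j}), Finset.sum_pair hij]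
  intro k _ hk
  simp only [Finset.mem_insert, Finset.mem_singleton, not_or] at hk
  simp [h k hk.1 hk.2]

lemma IsEdge.symm {V : Type*} [DecidableEq V] {𝒯 : Finset (Finset V)} {i j : V}
    (h : IsEdge 𝒯 i j) : IsEdge 𝒯 j i :=
  ⟨h.1.symm, h.2.imp fun _ hT => ⟨hT.1, hT.2.2, hT.2.1⟩⟩

namespace Conformal2D

variable {V : Type*} [Fintype V] [DecidableEq V] {𝒯 : Finset (Finset V)}
  {U : Set (V → ℝ)}

lemma len_comm (C : Conformal2D V 𝒯 U) (f : V → ℝ) (i j : V) :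
    C.len f i j = C.len f j i :=
  add_comm _ _

lemma ang_comm (C : Conformal2D V 𝒯 U) (f : V → ℝ) (i j k : V) :
    C.ang f i j k = C.ang f i k j := by
  rw [ang, ang, triAngle_comm, C.len_comm f j k]

lemma len_congr (C : Conformal2D V 𝒯 U) {i j : V} (hE : IsEdge 𝒯 i j) {f g : V → ℝ}
    (hi : f i = g i) (hj : f j = g j) : C.len f i j = C.len g i j := by
  rw [len, len, C.localDep i j hE f g hi hj, C.localDep j i hE.symm f g hj hi]

lemma differentiableAt_len (C : Conformal2D V 𝒯 U) {i j : V} (hE : IsEdge 𝒯 i j)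
    {x : V → ℝ} (hx : x ∈ U) : DifferentiableAt ℝ (fun y => C.len y i j) x :=
  (((C.smooth i j hE).contDiffAt (C.openU.mem_nhds hx)).differentiableAt (by simp)).add
    (((C.smooth j i hE.symm).contDiffAt (C.openU.mem_nhds hx)).differentiableAt (by simp))

lemma hasDerivAt_len_update (C : Conformal2D V 𝒯 U) {i j : V} (hE : IsEdge 𝒯 i j)
    {x : V → ℝ} (hx : x ∈ U) (k : V) :
    HasDerivAt (fun s => C.len (Function.update x k s) i j)
      (fderiv ℝ (fun y => C.len y i j) x (Pi.single k 1)) (x k) := by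
  have h := (C.differentiableAt_len hE hx).hasFDerivAt
  rw [← Function.update_eq_self k x] at h
  have h' := h.comp_hasDerivAt (x k) (hasDerivAt_update x k (x k))
  rwa [Function.update_eq_self] at h'

lemma fderiv_len_single (C : Conformal2D V 𝒯 U) {i j : V} (hE : IsEdge 𝒯 i j)
    {x : V → ℝ} (hx : x ∈ U) :
    fderiv ℝ (fun y => C.len y i j) x (Pi.single i 1) = C.d x i j :=
  (C.hasDerivAt_len_update hE hx i).unique (C.derivLen i j hE x hx)

/-- The derivative of an edge length along a curve. -/
lemma hasDerivAt_len (C : Conformal2D V 𝒯 U) {i j : V} (hE : IsEdge 𝒯 i j)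
    {f : ℝ → V → ℝ} {f' : V → ℝ} {t : ℝ} (hf : HasDerivAt f f' t) (hU : f t ∈ U) :
    HasDerivAt (fun s => C.len (f s) i j)
      (C.d (f t) i j * f' i + C.d (f t) j i * f' j) t := by
  refine ((C.differentiableAt_len hE hU).hasFDerivAt.comp_hasDerivAt t hf).congr_deriv ?_
  rw [ContinuousLinearMap.apply_eq_of_vanish_off_pair _ hE.1 ?_ f',
    C.fderiv_len_single hE hU]
  · congr 2
    rw [← C.fderiv_len_single hE.symm hU]
    simp only [C.len_comm _ i j]
  · intro k hki hkj
    refine (C.hasDerivAt_len_update hE hU k).unique ?_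
    refine (hasDerivAt_const (f t k) (C.len (f t) i j)).congr_of_eventuallyEq ?_
    exact Filter.Eventually.of_forall fun s => C.len_congr hE
      (Function.update_of_ne hki.symm _ _) (Function.update_of_ne hkj.symm _ _)

/-- The derivative of an angle along a curve. -/
lemma hasDerivAt_ang (C : Conformal2D V 𝒯 U) {i j k : V} (hT : {i, j, k} ∈ 𝒯)
    (hij : i ≠ j) (hik : i ≠ k) (hjk : j ≠ k)
    {f : ℝ → V → ℝ} {f' : V → ℝ} {t : ℝ} (hf : HasDerivAt f f' t) (hU : f t ∈ U) :
    HasDerivAt (fun s => C.ang (f s) i j k)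
      (C.hh (f t) i j k / C.len (f t) i j * (f' j - f' i)
        + C.hh (f t) i k j / C.len (f t) i k * (f' k - f' i)) t := by
  have hi : i ∈ ({i, j, k} : Finset V) := by simp
  have hj : j ∈ ({i, j, k} : Finset V) := by simp
  have hk : k ∈ ({i, j, k} : Finset V) := by simp
  have Eij : IsEdge 𝒯 i j := ⟨hij, _, hT, hi, hj⟩
  have Eik : IsEdge 𝒯 i k := ⟨hik, _, hT, hi, hk⟩
  have Ejk : IsEdge 𝒯 j k := ⟨hjk, _, hT, hj, hk⟩
  have pa : 0 < C.len (f t) i j := C.lenPos _ hU _ _ Eij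
  have pb : 0 < C.len (f t) i k := C.lenPos _ hU _ _ Eik
  have t₁ : C.len (f t) i j < C.len (f t) i k + C.len (f t) j k :=
    C.triIneq _ hU _ hT i hi j hj k hk hij hik hjk
  have t₂ : C.len (f t) i k < C.len (f t) i j + C.len (f t) j k := by
    rw [C.len_comm _ j k]
    exact C.triIneq _ hU _ hT i hi k hk j hj hik hij hjk.symm
  have t₃ : C.len (f t) j k < C.len (f t) i j + C.len (f t) i k := by
    rw [C.len_comm _ i j, C.len_comm _ i k]
    exact C.triIneq _ hU _ hT j hj k hk i hi hjk hij.symm hik.symm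
  refine ((C.hasDerivAt_len Eij hf hU).triAngle (C.hasDerivAt_len Eik hf hU)
    (C.hasDerivAt_len Ejk hf hU) pa pb t₁ t₂ t₃).congr_deriv ?_
  have hm := C.metricCond _ hU _ hT i hi j hj k hk hij hik hjk
  have hcos := cos_triAngle (abs_lt_one_cosine_law pa pb t₁ t₂ t₃).le
  rw [hh, hh, C.ang_comm _ i k j, ang]
  rw [eq_div_iff (by positivity)] at hcos
  generalize Real.sin (triAngle (C.len (f t) i j) (C.len (f t) i k) (C.len (f t) j k)) = r
  generalize Real.cos (triAngle (C.len (f t) i j) (C.len (f t) i k) (C.len (f t) j k)) = q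
    at hcos ⊢
  have hJ : q * C.len (f t) i j * C.len (f t) i k = C.len (f t) i k * C.d (f t) i k
      + C.len (f t) i j * C.d (f t) j i - C.len (f t) j k * C.d (f t) j k := by
    simp only [len] at hcos ⊢
    linear_combination hcos / 2 + hm / 2
  have hK : q * C.len (f t) i j * C.len (f t) i k = C.len (f t) i j * C.d (f t) i j
      + C.len (f t) i k * C.d (f t) k i - C.len (f t) j k * C.d (f t) k j := by
    simp only [len] at hcos ⊢
    linear_combination hcos / 2 - hm / 2
  have ea : C.d (f t) i j + C.d (f t) j i = C.len (f t) i j := rfl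
  have eb : C.d (f t) i k + C.d (f t) k i = C.len (f t) i k := rfl
  generalize C.len (f t) i j = a at *
  generalize C.len (f t) i k = b at *
  generalize C.len (f t) j k = c at *
  simp only [div_right_comm _ r, div_mul_eq_mul_div _ r, ← add_div]
  congr 1
  field_simp
  linear_combination f' j * hJ + f' k * hK + q * b * f' j * ea + q * a * f' k * eb

end Conformal2D

open Conformal2D in
/-- Under a conformal variation `f(t)`, at `t = 0`,
`(d/dt) K_i = −Σ_{{i,j,k} ∈ 𝒯} [(h_{ij,k}/ℓ_ij)(f_j′ − f_i′) + (h_{ik,j}/ℓ_ik)(f_k′ − f_i′)]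
 = −Σ_{j : {i,j} edge} (ℓ*_ij/ℓ_ij)(f_j′ − f_i′)`. -/
theorem curvature_variation_2d {V : Type*} [Fintype V] [DecidableEq V]
    {𝒯 : Finset (Finset V)} {U : Set (V → ℝ)} (C : Conformal2D V 𝒯 U)
    (ε : ℝ) (hε : 0 < ε) (f : ℝ → (V → ℝ))
    (hmem : ∀ t ∈ Set.Ioo (-ε) ε, f t ∈ U)
    (hsmooth : ContDiffOn ℝ (⊤ : ℕ∞) f (Set.Ioo (-ε) ε)) (i : V) :
    HasDerivAt (fun t => C.K (f t) i)
      (-((1 / 2) * ∑ j : V, ∑ k : V,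
        if ({i, j, k} : Finset V) ∈ 𝒯 ∧ i ≠ j ∧ i ≠ k ∧ j ≠ k then
          C.hh (f 0) i j k / C.len (f 0) i j
              * (deriv (fun t => f t j) 0 - deriv (fun t => f t i) 0)
            + C.hh (f 0) i k j / C.len (f 0) i k
              * (deriv (fun t => f t k) 0 - deriv (fun t => f t i) 0)
        else 0)) 0
    ∧ -((1 / 2) * ∑ j : V, ∑ k : V,
        if ({i, j, k} : Finset V) ∈ 𝒯 ∧ i ≠ j ∧ i ≠ k ∧ j ≠ k then
          C.hh (f 0) i j k / C.len (f 0) i j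
              * (deriv (fun t => f t j) 0 - deriv (fun t => f t i) 0)
            + C.hh (f 0) i k j / C.len (f 0) i k
              * (deriv (fun t => f t k) 0 - deriv (fun t => f t i) 0)
        else 0)
      = -∑ j : V,
          if IsEdge 𝒯 i j then
            C.dualLen (f 0) i j / C.len (f 0) i j
              * (deriv (fun t => f t j) 0 - deriv (fun t => f t i) 0)
          else 0 := by
  have h0 : (0 : ℝ) ∈ Set.Ioo (-ε) ε := ⟨neg_lt_zero.mpr hε, hε⟩
  have hd : DifferentiableAt ℝ f 0 :=
    (hsmooth.contDiffAt (Ioo_mem_nhds h0.1 h0.2)).differentiableAt (by simp)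
  have hf : HasDerivAt f (fun j => deriv (fun t => f t j) 0) 0 :=
    hasDerivAt_pi.mpr fun j => (differentiableAt_pi.mp hd j).hasDerivAt
  constructor
  · refine HasDerivAt.const_sub _ (HasDerivAt.const_mul _ ?_)
    refine HasDerivAt.fun_sum fun j _ => HasDerivAt.fun_sum fun k _ => ?_
    split_ifs with h
    · exact C.hasDerivAt_ang h.1 h.2.1 h.2.2.1 h.2.2.2 hf (hmem 0 h0)
    · exact hasDerivAt_const _ _
  · set A : V → V → ℝ := fun j k =>
      if ({i, j, k} : Finset V) ∈ 𝒯 ∧ i ≠ j ∧ i ≠ k ∧ j ≠ k then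
        C.hh (f 0) i j k / C.len (f 0) i j
          * (deriv (fun t => f t j) 0 - deriv (fun t => f t i) 0)
      else 0 with hA
    have hsymm (j k : V) : (({i, k, j} : Finset V) ∈ 𝒯 ∧ i ≠ k ∧ i ≠ j ∧ k ≠ j) ↔
        (({i, j, k} : Finset V) ∈ 𝒯 ∧ i ≠ j ∧ i ≠ k ∧ j ≠ k) := by
      rw [Finset.pair_comm k j, ne_comm (a := k) (b := j)]
      tauto
    have hsplit : (∑ j, ∑ k, (A j k + A k j)) = 2 * ∑ j, ∑ k, A j k := by
      simp only [Finset.sum_add_distrib]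
      rw [Finset.sum_comm (f := fun j k => A k j)]
      ring
    have hrow (j : V) : ∑ k, A j k = if IsEdge 𝒯 i j then
        C.dualLen (f 0) i j / C.len (f 0) i j
          * (deriv (fun t => f t j) 0 - deriv (fun t => f t i) 0) else 0 := by
      split_ifs with hE
      · simp only [hA, dualLen, Finset.sum_div, Finset.sum_mul, ite_div, ite_mul, zero_div,
          zero_mul]
      · refine Finset.sum_eq_zero fun k _ => if_neg fun h => ?_
        exact hE ⟨h.2.1, _, h.1, by simp, by simp⟩
    rw [← Finset.sum_congr rfl fun j _ => hrow j, neg_inj]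
    trans (1 / 2) * ∑ j, ∑ k, (A j k + A k j)
    · congr 1
      refine Finset.sum_congr rfl fun j _ => Finset.sum_congr rfl fun k _ => ?_
      simp only [hA, hsymm j k]
      split_ifs <;> simp
    · rw [hsplit]
      ring
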